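/- Let g ≥ 1 be a natural number, let μ ∈ ℝ, σ > 0, x ∈ ℝ, t ∈ ℝ, and for ε ∈ [0,1] let F_ε = (1−ε)·Φ_{μ,σ} + ε·δ_x be the point-mass contaminated Gaussian measure on ℝ. If Z₁,…,Z_g are i.i.d. with common law F_ε (i.e. one takes the g-fold product measure F_ε^{⊗g}), then the tail probability of the sum of squared standardized coordinates admits the exact binomial decomposition P_{F_ε^{⊗g}}( Σ_{i=1}^g ((Z_i−μ)/σ)² > t ) = Σ_{j=0}^{g} C(g,j) ε^j (1−ε)^{g−j} · P( χ²_{g−j} > t − j·((x−μ)/σ)² ). -/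

import Mathlib

open MeasureTheory ProbabilityTheory

/-- The chi-square distribution with `m` degrees of freedom, i.e. the gamma distribution with
shape `m/2` and rate `1/2`, with the convention that `χ²₀` is the Dirac mass at `0`. -/
noncomputable def chiSqMeasure (m : ℕ) : Measure ℝ :=
  if m = 0 then Measure.dirac 0 else gammaMeasure ((m : ℝ) / 2) (1 / 2)

/-- The moment-generating function of a gamma distribution. -/
lemma mgf_id_gammaMeasure {a r t : ℝ} (ha : 0 < a) (hr : 0 < r) (ht : t < r) :
    mgf id (gammaMeasure a r) t = (r / (r - t)) ^ a := by
  have hdensity (x : ℝ) : (gammaPDF a r x).toReal • Real.exp (t * x)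
      = (Set.Ici (0 : ℝ)).indicator (fun x : ℝ ↦ r ^ a / Real.Gamma a *
          (x ^ (a - 1) * Real.exp (-((r - t) * x)))) x := by
    rw [gammaPDF, ENNReal.toReal_ofReal (gammaPDFReal_nonneg ha hr x), gammaPDFReal]
    by_cases hx : 0 ≤ x
    · have hexp : Real.exp (-((r - t) * x)) = Real.exp (-(r * x)) * Real.exp (t * x) := by
        rw [← Real.exp_add]
        ring_nf
      rw [if_pos hx, Set.indicator_of_mem (Set.mem_Ici.mpr hx), smul_eq_mul, hexp]
      ring
    · rw [if_neg hx, Set.indicator_of_notMem (by simpa using hx), zero_smul]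
  have hGamma := (Real.Gamma_pos_of_pos ha).ne'
  simp only [mgf, gammaMeasure, id]
  unfold gammaPDF at hdensity ⊢
  rw [integral_withDensity_eq_integral_toReal_smul
    (measurable_gammaPDFReal a r).ennreal_ofReal (ae_of_all _ fun _ ↦ ENNReal.ofReal_lt_top)]
  simp_rw [hdensity]
  rw [integral_indicator measurableSet_Ici, integral_Ici_eq_integral_Ioi, integral_const_mul,
    Real.integral_rpow_mul_exp_neg_mul_Ioi ha (sub_pos.mpr ht), div_eq_mul_one_div r (r - t),
    Real.mul_rpow hr.le (one_div_nonneg.mpr (sub_pos.mpr ht).le)]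
  field_simp

lemma Iio_subset_integrableExpSet_gammaMeasure {a r : ℝ} (ha : 0 < a) (hr : 0 < r) :
    Set.Iio r ⊆ integrableExpSet id (gammaMeasure a r) := by
  intro t ht
  have := isProbabilityMeasure_gammaMeasure ha hr
  refine mgf_pos_iff.mp ?_
  rw [mgf_id_gammaMeasure ha hr ht]
  exact Real.rpow_pos_of_pos (div_pos hr (sub_pos.mpr ht)) a

/-- The complex moment-generating function of a gamma distribution. -/
lemma complexMGF_id_gammaMeasure {a r : ℝ} (ha : 0 < a) (hr : 0 < r) {z : ℂ} (hz : z.re < r) :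
    complexMGF id (gammaMeasure a r) z = (r / (r - z) : ℂ) ^ (a : ℂ) := by
  have hconvex : Convex ℝ {z : ℂ | z.re < r} := convex_halfSpace_re_lt r
  have hopen : IsOpen {z : ℂ | z.re < r} := isOpen_Iio.preimage Complex.continuous_re
  have hleft : AnalyticOnNhd ℂ (complexMGF id (gammaMeasure a r)) {z | z.re < r} :=
    analyticOnNhd_complexMGF.mono fun z hz ↦
      interior_maximal (Iio_subset_integrableExpSet_gammaMeasure ha hr) isOpen_Iio hz
  have hright : AnalyticOnNhd ℂ (fun z : ℂ ↦ (r / (r - z) : ℂ) ^ (a : ℂ)) {z | z.re < r} := by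
    refine DifferentiableOn.analyticOnNhd (fun z (hz : z.re < r) ↦ ?_) hopen
    have hpos : 0 < (r - z : ℂ).re := by simpa using hz
    have hne : (r - z : ℂ) ≠ 0 := fun h ↦ by simp [h] at hpos
    refine (DifferentiableAt.cpow (by fun_prop (disch := exact hne)) (by fun_prop)
      (Or.inl ?_)).differentiableWithinAt
    rw [div_eq_mul_inv, Complex.re_ofReal_mul, Complex.inv_re]
    exact mul_pos hr (div_pos hpos (Complex.normSq_pos.mpr hne))
  refine hleft.eqOn_of_preconnected_of_frequently_eq hright hconvex.isPreconnected
    (z₀ := 0) (by simpa using hr) ?_ hz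
  have hreal : Filter.Tendsto ((↑) : ℝ → ℂ) (nhdsWithin 0 {0}ᶜ) (nhdsWithin 0 {0}ᶜ) := by
    refine tendsto_nhdsWithin_iff.mpr ⟨?_, ?_⟩
    · exact (Complex.continuous_ofReal.tendsto' 0 0 rfl).mono_left nhdsWithin_le_nhds
    · filter_upwards [self_mem_nhdsWithin] with t ht
      simpa using ht
  refine hreal.frequently (Filter.Eventually.frequently ?_)
  filter_upwards [nhdsWithin_le_nhds (Iio_mem_nhds hr)] with t (ht : t < r)
  rw [complexMGF_ofReal, mgf_id_gammaMeasure ha hr ht,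
    Complex.ofReal_cpow (div_nonneg hr.le (sub_pos.mpr ht).le)]
  push_cast
  rfl

/-- The characteristic function of a gamma distribution. -/
lemma charFun_gammaMeasure {a r : ℝ} (ha : 0 < a) (hr : 0 < r) (t : ℝ) :
    charFun (gammaMeasure a r) t = (r / (r - t * Complex.I) : ℂ) ^ (a : ℂ) := by
  rw [← complexMGF_id_mul_I, complexMGF_id_gammaMeasure ha hr (by simpa using hr)]

lemma ofReal_mul_cpow {r : ℝ} (hr : 0 < r) {w : ℂ} (hw : w ≠ 0) (s : ℂ) :
    (r * w) ^ s = (r : ℂ) ^ s * w ^ s := by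
  have hr' : (r : ℂ) ≠ 0 := Complex.ofReal_ne_zero.mpr hr.ne'
  rw [Complex.cpow_def_of_ne_zero (mul_ne_zero hr' hw), Complex.cpow_def_of_ne_zero hr',
    Complex.cpow_def_of_ne_zero hw, Complex.log_ofReal_mul hr hw, Complex.ofReal_log hr.le,
    add_mul, Complex.exp_add]

/-- The characteristic function of the square of a standard Gaussian variable. -/
lemma integral_cexp_mul_sq_gaussianReal (t : ℝ) :
    ∫ x, Complex.exp (t * (x ^ 2 : ℝ) * Complex.I) ∂gaussianReal 0 1
      = ((1 / 2 : ℝ) / ((1 / 2 : ℝ) - t * Complex.I) : ℂ) ^ (1 / 2 : ℂ) := by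
  have hdensity (x : ℝ) : gaussianPDFReal 0 1 x • Complex.exp (t * (x ^ 2 : ℝ) * Complex.I)
      = ((√(2 * Real.pi))⁻¹ : ℝ) * Complex.exp (-((1 / 2 : ℝ) - t * Complex.I) * x ^ 2) := by
    have hexp : Complex.exp (-((1 / 2 : ℝ) - t * Complex.I) * x ^ 2)
        = Complex.exp (-x ^ 2 / 2) * Complex.exp (t * x ^ 2 * Complex.I) := by
      rw [← Complex.exp_add]; push_cast; ring_nf
    rw [hexp, gaussianPDFReal, Complex.real_smul]
    simp [mul_assoc]
  rw [integral_gaussianReal_eq_integral_smul one_ne_zero]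
  simp_rw [hdensity]
  rw [integral_const_mul, integral_gaussian_complex (by simp)]
  have hpi : ((1 / 2 : ℝ) / ((1 / 2 : ℝ) - t * Complex.I) : ℂ)
      = ((2 * Real.pi)⁻¹ : ℝ) * (Real.pi / ((1 / 2 : ℝ) - t * Complex.I)) := by
    have := Real.pi_ne_zero
    push_cast
    field_simp
  have hne : ((1 / 2 : ℝ) - t * Complex.I : ℂ) ≠ 0 := fun h ↦ by
    simpa using congrArg Complex.re h
  rw [hpi, ofReal_mul_cpow (by positivity)
      (div_ne_zero (Complex.ofReal_ne_zero.mpr Real.pi_ne_zero) hne), ← Real.sqrt_inv, Real.sqrt_eq_rpow,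
    Complex.ofReal_cpow (by positivity)]
  push_cast
  rfl

instance (m : ℕ) : IsProbabilityMeasure (chiSqMeasure m) := by
  unfold chiSqMeasure
  split_ifs with hm
  · infer_instance
  · exact isProbabilityMeasure_gammaMeasure (by positivity) (by norm_num)

/-- The characteristic function of the chi-square distribution. -/
lemma charFun_chiSqMeasure (m : ℕ) (t : ℝ) :
    charFun (chiSqMeasure m) t
      = (((1 / 2 : ℝ) / ((1 / 2 : ℝ) - t * Complex.I) : ℂ) ^ (1 / 2 : ℂ)) ^ m := by
  rcases eq_or_ne m 0 with rfl | hm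
  · simp [chiSqMeasure]
  · rw [chiSqMeasure, if_neg hm, charFun_gammaMeasure (by positivity) (by norm_num),
      ← Complex.cpow_nat_mul]
    push_cast
    congr 1
    ring

/-- The characteristic function of the square of a standardized contaminated Gaussian variable. -/
lemma integral_cexp_mul_sq_contaminated {μ σ : ℝ} (hσ : 0 < σ) {v : NNReal} (hv : (v : ℝ) = σ ^ 2) (x t : ℝ) {ε : ℝ}
    (hε : ε ∈ Set.Icc (0 : ℝ) 1) :
    ∫ z, Complex.exp (t * (((z - μ) / σ) ^ 2 : ℝ) * Complex.I)
        ∂(ENNReal.ofReal (1 - ε) • gaussianReal μ v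
          + ENNReal.ofReal ε • Measure.dirac x)
      = ε * Complex.exp (t * (((x - μ) / σ) ^ 2 : ℝ) * Complex.I)
        + (1 - ε) * ((1 / 2 : ℝ) / ((1 / 2 : ℝ) - t * Complex.I) : ℂ) ^ (1 / 2 : ℂ) := by
  have hbound (z : ℝ) : ‖Complex.exp (t * (((z - μ) / σ) ^ 2 : ℝ) * Complex.I)‖ ≤ 1 := by
    rw [← Complex.ofReal_mul, Complex.norm_exp_ofReal_mul_I]
  have hint (ν : Measure ℝ) [IsFiniteMeasure ν] :
      Integrable (fun z ↦ Complex.exp (t * (((z - μ) / σ) ^ 2 : ℝ) * Complex.I)) ν :=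
    Integrable.of_bound (by fun_prop) 1 (ae_of_all _ hbound)
  have hmap : (gaussianReal μ v).map (fun z ↦ (z - μ) / σ)
      = gaussianReal 0 1 := by
    have hcomp : (fun z ↦ (z - μ) / σ) = (· / σ) ∘ (· - μ) := rfl
    rw [hcomp, ← Measure.map_map (by fun_prop) (by fun_prop), gaussianReal_map_sub_const,
      gaussianReal_map_div_const, sub_self, zero_div]
    congr 1
    ext
    simp [hv, hσ.ne']
  rw [integral_add_measure ((hint _).smul_measure ENNReal.ofReal_ne_top)
    ((hint _).smul_measure ENNReal.ofReal_ne_top), integral_smul_measure, integral_smul_measure,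
    integral_dirac, ENNReal.toReal_ofReal (sub_nonneg.mpr hε.2), ENNReal.toReal_ofReal hε.1,
    ← integral_cexp_mul_sq_gaussianReal, ← hmap,
    integral_map (by fun_prop) (by fun_prop), Complex.real_smul, Complex.real_smul, add_comm]
  push_cast
  rfl

/-- The law of the sum of squares of standardized contaminated Gaussian variables is a binomial
mixture of shifted chi-square distributions. -/
lemma map_sum_sq_pi_contaminated (g : ℕ) {μ σ : ℝ} (hσ : 0 < σ) {v : NNReal} (hv : (v : ℝ) = σ ^ 2) (x : ℝ) {ε : ℝ}
    (hε : ε ∈ Set.Icc (0 : ℝ) 1) :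
    (Measure.pi fun _ : Fin g =>
        (ENNReal.ofReal (1 - ε) • gaussianReal μ v
          + ENNReal.ofReal ε • Measure.dirac x)).map (fun z ↦ ∑ i, ((z i - μ) / σ) ^ 2)
      = ∑ j ∈ Finset.range (g + 1),
          ENNReal.ofReal ((g.choose j : ℝ) * ε ^ j * (1 - ε) ^ (g - j)) •
            (chiSqMeasure (g - j)).map (· + (j : ℝ) * ((x - μ) / σ) ^ 2) := by
  have hε' : 0 ≤ 1 - ε := sub_nonneg.mpr hε.2
  have : ∀ j, IsFiniteMeasure (ENNReal.ofReal ((g.choose j : ℝ) * ε ^ j * (1 - ε) ^ (g - j)) •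
      (chiSqMeasure (g - j)).map (· + (j : ℝ) * ((x - μ) / σ) ^ 2)) :=
    fun j ↦ Measure.smul_finite _ ENNReal.ofReal_ne_top
  have : IsFiniteMeasure (ENNReal.ofReal (1 - ε) • gaussianReal μ v
      + ENNReal.ofReal ε • Measure.dirac x) := by
    have := Measure.smul_finite (gaussianReal μ v)
      (ENNReal.ofReal_ne_top (r := 1 - ε))
    have := Measure.smul_finite (Measure.dirac x) (ENNReal.ofReal_ne_top (r := ε))
    infer_instance
  refine Measure.ext_of_charFun (funext fun t ↦ ?_)
  have hint (ν : Measure ℝ) [IsFiniteMeasure ν] :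
      Integrable (fun y : ℝ ↦ Complex.exp (t * y * Complex.I)) ν :=
    Integrable.of_bound (by fun_prop) 1 (ae_of_all _ fun y ↦ by
      rw [← Complex.ofReal_mul, Complex.norm_exp_ofReal_mul_I])
  have hprod (z : Fin g → ℝ) :
      Complex.exp (t * (∑ i, ((z i - μ) / σ) ^ 2 : ℝ) * Complex.I)
        = ∏ i, Complex.exp (t * (((z i - μ) / σ) ^ 2 : ℝ) * Complex.I) := by
    rw [← Complex.exp_sum, Complex.ofReal_sum, Finset.mul_sum, Finset.sum_mul]
  have hmeas : Measurable fun z : Fin g → ℝ ↦ ∑ i, ((z i - μ) / σ) ^ 2 := by fun_prop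
  rw [charFun_apply_real, charFun_apply_real, integral_map hmeas.aemeasurable (by fun_prop),
    integral_finsetSum_measure fun j _ ↦ hint _]
  simp_rw [hprod]
  rw [integral_fintype_prod_eq_pow
    (fun y : ℝ ↦ Complex.exp (t * (((y - μ) / σ) ^ 2 : ℝ) * Complex.I)),
    integral_cexp_mul_sq_contaminated hσ hv x t hε, Fintype.card_fin, add_pow]
  refine Finset.sum_congr rfl fun j _ ↦ ?_
  have hcoef : 0 ≤ (g.choose j : ℝ) * ε ^ j * (1 - ε) ^ (g - j) :=
    mul_nonneg (mul_nonneg (Nat.cast_nonneg _) (pow_nonneg hε.1 _)) (pow_nonneg hε' _)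
  rw [integral_smul_measure, ← charFun_apply_real, charFun_map_add_const, charFun_chiSqMeasure,
    ENNReal.toReal_ofReal hcoef, Complex.real_smul, mul_pow, mul_pow, ← Complex.exp_nat_mul]
  simp only [RCLike.inner_apply, conj_trivial]
  push_cast
  ring_nf

/-- Tail probabilities of sums of squares of standardized contaminated Gaussian variables. -/
lemma pi_contaminated_sum_sq_tail (g : ℕ) {μ σ : ℝ} (hσ : 0 < σ) {v : NNReal}
    (hv : (v : ℝ) = σ ^ 2) (x t : ℝ) {ε : ℝ} (hε : ε ∈ Set.Icc (0 : ℝ) 1) :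
    ((Measure.pi fun _ : Fin g =>
        (ENNReal.ofReal (1 - ε) • gaussianReal μ v
          + ENNReal.ofReal ε • Measure.dirac x))
      {z | t < ∑ i, ((z i - μ) / σ) ^ 2}).toReal
    = ∑ j ∈ Finset.range (g + 1),
        (g.choose j : ℝ) * ε ^ j * (1 - ε) ^ (g - j) *
          ((chiSqMeasure (g - j)) (Set.Ioi (t - (j : ℝ) * ((x - μ) / σ) ^ 2))).toReal := by
  have hmeas : Measurable fun z : Fin g → ℝ ↦ ∑ i, ((z i - μ) / σ) ^ 2 := by fun_prop
  have hpre : {z : Fin g → ℝ | t < ∑ i, ((z i - μ) / σ) ^ 2}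
      = (fun z ↦ ∑ i, ((z i - μ) / σ) ^ 2) ⁻¹' Set.Ioi t := rfl
  rw [hpre, ← Measure.map_apply hmeas measurableSet_Ioi, map_sum_sq_pi_contaminated g hσ hv x hε,
    Measure.finsetSum_apply, ENNReal.toReal_sum]
  · refine Finset.sum_congr rfl fun j _ ↦ ?_
    have hcoef : 0 ≤ (g.choose j : ℝ) * ε ^ j * (1 - ε) ^ (g - j) :=
      mul_nonneg (mul_nonneg (Nat.cast_nonneg _) (pow_nonneg hε.1 _))
        (pow_nonneg (sub_nonneg.mpr hε.2) _)
    rw [Measure.smul_apply, smul_eq_mul, ENNReal.toReal_mul, ENNReal.toReal_ofReal hcoef,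
      Measure.map_apply (by fun_prop) measurableSet_Ioi, Set.preimage_add_const_Ioi]
  · intro j _
    rw [Measure.smul_apply, smul_eq_mul]
    have := Measure.isProbabilityMeasure_map (μ := chiSqMeasure (g - j))
      (f := (· + (j : ℝ) * ((x - μ) / σ) ^ 2)) (by fun_prop)
    exact ENNReal.mul_ne_top ENNReal.ofReal_ne_top (measure_ne_top _ _)

theorem stmt0 (g : ℕ) (hg : 1 ≤ g) (μ σ x t : ℝ) (hσ : 0 < σ)
    (ε : ℝ) (hε : ε ∈ Set.Icc (0 : ℝ) 1) :
    ((Measure.pi fun _ : Fin g =>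
        (ENNReal.ofReal (1 - ε) • gaussianReal μ ⟨σ ^ 2, sq_nonneg σ⟩
          + ENNReal.ofReal ε • Measure.dirac x))
      {z | t < ∑ i, ((z i - μ) / σ) ^ 2}).toReal
    = ∑ j ∈ Finset.range (g + 1),
        (g.choose j : ℝ) * ε ^ j * (1 - ε) ^ (g - j) *
          ((chiSqMeasure (g - j)) (Set.Ioi (t - (j : ℝ) * ((x - μ) / σ) ^ 2))).toReal := by
  exact pi_contaminated_sum_sq_tail g hσ rfl x t hε
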